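/- Let S_L = Σ_{i=1}^{𝓛} L_i and S_R = Σ_{j=1}^{ℛ} R_j. Then the set A* = { i : S_L − S_R ≤ L_i } is an optimal partial left marking, i.e. E(A*, ∅) ≤ E(A, ∅) for every A ⊆ {1,…,𝓛}; and symmetrically, B* = { j : S_R − S_L ≤ R_j } is an optimal partial right marking, i.e. E(∅, B*) ≤ E(∅, B) for every B ⊆ {1,…,ℛ}. -/

import Mathlib

open Finset in
/-- For a contracted edge `e*` in a weighted tree with `l` left and `r` right neighbouring
edges, where the subtree hanging off the `i`-th left (resp. `j`-th right) neighbouring edge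
has `L i` (resp. `R j`) vertices, and a marking `(A, B)` of left/right neighbouring edges,
the error (in units of `w*`) is
`E(A,B) = 2·Σ_{i<j ∈ A} L_i·L_j + 2·Σ_{i<j ∈ B} R_i·R_j + Σ_{i∈A, j∈B} L_i·R_j`
`  + Σ_{i∈A, i′∉A} L_i·L_{i′} + Σ_{j∈B, j′∉B} R_j·R_{j′} + Σ_{i∉A, j∉B} L_i·R_j`. -/
def markErr {l r : ℕ} (L : Fin l → ℕ) (R : Fin r → ℕ)
    (A : Finset (Fin l)) (B : Finset (Fin r)) : ℕ :=
  2 * (∑ i ∈ A, ∑ j ∈ A, if i < j then L i * L j else 0)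
    + 2 * (∑ i ∈ B, ∑ j ∈ B, if i < j then R i * R j else 0)
    + (∑ i ∈ A, ∑ j ∈ B, L i * R j)
    + (∑ i ∈ A, ∑ j ∈ Aᶜ, L i * L j)
    + (∑ i ∈ B, ∑ j ∈ Bᶜ, R i * R j)
    + (∑ i ∈ Aᶜ, ∑ j ∈ Bᶜ, L i * R j)

/-- The square of a finite sum, split into the off-diagonal and the diagonal part. -/
theorem two_mul_sum_lt_add_sum_sq {ι M : Type*} [LinearOrder ι] [CommSemiring M]
    (s : Finset ι) (f : ι → M) :
    2 * (∑ i ∈ s, ∑ j ∈ s, if i < j then f i * f j else 0) + ∑ i ∈ s, f i ^ 2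
      = (∑ i ∈ s, f i) ^ 2 := by
  have hswap : (∑ i ∈ s, ∑ j ∈ s, if i < j then f i * f j else 0)
      = ∑ i ∈ s, ∑ j ∈ s, if j < i then f i * f j else 0 := by
    rw [Finset.sum_comm]
    simp only [mul_comm]
  have hdiag : ∑ i ∈ s, f i ^ 2 = ∑ i ∈ s, ∑ j ∈ s, if i = j then f i * f j else 0 := by
    refine Finset.sum_congr rfl fun i hi => ?_
    simp [hi, sq]
  rw [two_mul]
  nth_rewrite 2 [hswap]
  rw [hdiag, sq, Finset.sum_mul_sum]
  simp only [← Finset.sum_add_distrib]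
  refine Finset.sum_congr rfl fun i _ => Finset.sum_congr rfl fun j _ => ?_
  rcases lt_trichotomy i j with h | rfl | h
  · simp [h, h.not_gt, h.ne]
  · simp
  · simp [h, h.not_gt, h.ne']

/-- A sum over a finset is at least the sum over the set of all indices with nonpositive terms. -/
theorem sum_filter_nonpos_le_sum {ι M : Type*} [Fintype ι] [AddCommMonoid M] [LinearOrder M]
    [IsOrderedAddMonoid M] (f : ι → M) (s : Finset ι) :
    ∑ i with f i ≤ 0, f i ≤ ∑ i ∈ s, f i := by
  classical
  have hs : ∑ i ∈ s, f i = ∑ i, if i ∈ s then f i else 0 := by simp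
  rw [Finset.sum_filter, hs]
  refine Finset.sum_le_sum fun i _ => ?_
  split_ifs with hneg hmem hmem
  · exact le_rfl
  · exact hneg
  · exact (not_le.mp hneg).le
  · exact le_rfl

theorem markErr_comm {l r : ℕ} (L : Fin l → ℕ) (R : Fin r → ℕ)
    (A : Finset (Fin l)) (B : Finset (Fin r)) : markErr L R A B = markErr R L B A := by
  unfold markErr
  rw [Finset.sum_comm (s := A) (t := B), Finset.sum_comm (s := Aᶜ) (t := Bᶜ)]
  simp only [mul_comm (L _) (R _)]
  ring

/-- The error of a partial left marking is a constant plus a sum of independent contributions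
of the marked edges. -/
theorem markErr_empty_right {l r : ℕ} (L : Fin l → ℕ) (R : Fin r → ℕ) (A : Finset (Fin l)) :
    (markErr L R A ∅ : ℤ) = (∑ i, (L i : ℤ)) * (∑ j, (R j : ℤ))
      + ∑ i ∈ A, (L i : ℤ) * ((∑ i', (L i' : ℤ)) - (∑ j, (R j : ℤ)) - L i) := by
  have hsq := two_mul_sum_lt_add_sum_sq A (fun i => (L i : ℤ))
  have hcompl := Finset.sum_add_sum_compl A (fun i => (L i : ℤ))
  simp only [markErr, Finset.sum_empty, Finset.sum_const_zero, Finset.compl_empty,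
    ← Finset.sum_mul_sum]
  push_cast
  simp only [mul_sub, Finset.sum_sub_distrib, ← Finset.sum_mul, ← sq]
  rw [← hcompl]
  linear_combination hsq

theorem markErr_filter_empty_le {l r : ℕ} (L : Fin l → ℕ) (R : Fin r → ℕ)
    (hL : ∀ i, 1 ≤ L i) (A : Finset (Fin l)) :
    markErr L R (Finset.univ.filter
        (fun i => (∑ i', (L i' : ℤ)) - (∑ j', (R j' : ℤ)) ≤ (L i : ℤ))) ∅
      ≤ markErr L R A ∅ := by
  have hfilter : (Finset.univ.filter
        (fun i => (∑ i', (L i' : ℤ)) - (∑ j', (R j' : ℤ)) ≤ (L i : ℤ)))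
      = Finset.univ.filter
        (fun i => (L i : ℤ) * ((∑ i', (L i' : ℤ)) - (∑ j, (R j : ℤ)) - L i) ≤ 0) := by
    refine Finset.filter_congr fun i _ => ?_
    have hpos : (0 : ℤ) < L i := by exact_mod_cast hL i
    rw [← sub_nonpos, ← not_lt, ← not_lt, mul_pos_iff_of_pos_left hpos]
  zify
  rw [markErr_empty_right, markErr_empty_right, hfilter]
  exact add_le_add_right (sum_filter_nonpos_le_sum _ A) _

/-- With `S_L = Σ_i L_i` and `S_R = Σ_j R_j`, the set `A* = {i : S_L − S_R ≤ L_i}` is an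
optimal partial left marking, and symmetrically `B* = {j : S_R − S_L ≤ R_j}` is an
optimal partial right marking. -/
theorem optimal_partial_markings (l r : ℕ) (hl : 1 ≤ l) (hr : 1 ≤ r)
    (L : Fin l → ℕ) (R : Fin r → ℕ) (hL : ∀ i, 1 ≤ L i) (hR : ∀ j, 1 ≤ R j) :
    (∀ A : Finset (Fin l),
        markErr L R (Finset.univ.filter
            (fun i => (∑ i', (L i' : ℤ)) - (∑ j', (R j' : ℤ)) ≤ (L i : ℤ))) ∅
          ≤ markErr L R A ∅) ∧
    (∀ B : Finset (Fin r),
        markErr L R ∅ (Finset.univ.filter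
            (fun j => (∑ j', (R j' : ℤ)) - (∑ i', (L i' : ℤ)) ≤ (R j : ℤ)))
          ≤ markErr L R ∅ B) := by
  refine ⟨markErr_filter_empty_le L R hL, fun B => ?_⟩
  rw [markErr_comm L R ∅, markErr_comm L R ∅]
  exact markErr_filter_empty_le R L hR B
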